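/- Let F', F''' ∈ 𝓕 with (1/w)(F') < (1/w)(F*) < (1/w)(F'''), let δ, Δ ∈ ℝ with δ ≥ f_7(c, F', F'''), and set p := p^{δ,Δ}_w. Then it is not the case that (c − p)(F') < (c − p)(F*) = (c − p)(F'''), and it is not the case that (c − p)(F') = (c − p)(F*) > (c − p)(F'''). -/

import Mathlib

open Finset

noncomputable section

variable {S : Type*}

/-- Sum of a real-valued function over a finite subset: `f(X) = ∑_{s∈X} f(s)`. -/
def costSum (c : S → ℝ) (X : Finset S) : ℝ := ∑ s ∈ X, c s

/-- `(1/w)(X) = ∑_{s∈X} 1/w(s)`. -/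
def invw (w : S → ℝ) (X : Finset S) : ℝ := ∑ s ∈ X, 1 / w s

/-- The untruncated deviation vector `p^{δ,Δ}_w`: value `(δ+Δ)/w(s)` on `F*`
and `Δ/w(s)` outside `F*`. -/
def pddU [DecidableEq S] (Fstar : Finset S) (w : S → ℝ) (δ Δ : ℝ) (s : S) : ℝ :=
  if s ∈ Fstar then (δ + Δ) / w s else Δ / w s

/-- The quantity `f₇(c, F', F''')` of the paper (with `(1/w)` in place of `μ`). -/
def f7 (w : S → ℝ) (c : S → ℝ) (Fstar F' F''' : Finset S)
    [DecidableEq S] : ℝ :=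
  ((costSum c Fstar - costSum c F') / (invw w Fstar - invw w F') -
   (costSum c Fstar - costSum c F''') / (invw w Fstar - invw w F''')) /
  (invw w (Fstar \ F') / (invw w Fstar - invw w F') -
   invw w (Fstar \ F''') / (invw w Fstar - invw w F'''))

/-- The difference of the modified costs `c - p` of `F*` and `X` is affine in `δ` and `Δ`. -/
lemma costSum_sub_pddU_sub [DecidableEq S] (Fstar X : Finset S) (c w : S → ℝ) (δ Δ : ℝ) :
    costSum (fun s => c s - pddU Fstar w δ Δ s) Fstar -
      costSum (fun s => c s - pddU Fstar w δ Δ s) X =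
    costSum c Fstar - costSum c X - δ * invw w (Fstar \ X) -
      Δ * (invw w Fstar - invw w X) := by
  have key (Y : Finset S) : costSum (fun s => c s - pddU Fstar w δ Δ s) Y =
      costSum c Y - δ * invw w (Y ∩ Fstar) - Δ * invw w Y := by
    simp only [costSum, invw, pddU, ← Finset.filter_mem_eq_inter, Finset.sum_filter,
      Finset.mul_sum, ← Finset.sum_sub_distrib]
    refine Finset.sum_congr rfl fun s _ => ?_
    split_ifs <;> ring
  have hsplit : invw w (Fstar ∩ X) + invw w (Fstar \ X) = invw w Fstar :=
    Finset.sum_inter_add_sum_sdiff Fstar X _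
  rw [key, key, Finset.inter_self, Finset.inter_comm X, ← hsplit]
  ring

lemma invw_nonneg {w : S → ℝ} (hw : ∀ s, 0 < w s) (X : Finset S) : 0 ≤ invw w X :=
  Finset.sum_nonneg fun s _ => (one_div_pos.2 (hw s)).le

lemma invw_sub_le_invw_sdiff [DecidableEq S] {w : S → ℝ} (hw : ∀ s, 0 < w s)
    (X Y : Finset S) : invw w X - invw w Y ≤ invw w (X \ Y) := by
  have hsplit : invw w (X ∩ Y) + invw w (X \ Y) = invw w X :=
    Finset.sum_inter_add_sum_sdiff X Y _
  have hle : invw w (X ∩ Y) ≤ invw w Y :=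
    Finset.sum_le_sum_of_subset_of_nonneg Finset.inter_subset_right
      fun s _ _ => (one_div_pos.2 (hw s)).le
  linarith

/-- Let `F', F''' ∈ 𝓕` with `(1/w)(F') < (1/w)(F*) < (1/w)(F''')`, and let
`δ ≥ f₇(c, F', F''')`, `p = p^{δ,Δ}_w`. Then neither
`(c−p)(F') < (c−p)(F*) = (c−p)(F''')` nor
`(c−p)(F') = (c−p)(F*) > (c−p)(F''')` holds. -/
theorem stmt15 [Fintype S] [DecidableEq S] [Nonempty S]
    (𝓕 : Finset (Finset S)) (Fstar : Finset S) (hFstar : Fstar ∈ 𝓕)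
    (c w : S → ℝ) (hw : ∀ s, 0 < w s)
    (F' F''' : Finset S) (hF' : F' ∈ 𝓕) (hF''' : F''' ∈ 𝓕)
    (h1 : invw w F' < invw w Fstar) (h2 : invw w Fstar < invw w F''')
    (δ Δ : ℝ) (hδ : f7 w c Fstar F' F''' ≤ δ)
    (p : S → ℝ) (hp : p = pddU Fstar w δ Δ) :
    ¬ (costSum (fun s => c s - p s) F' < costSum (fun s => c s - p s) Fstar ∧
        costSum (fun s => c s - p s) Fstar = costSum (fun s => c s - p s) F''') ∧
    ¬ (costSum (fun s => c s - p s) F' = costSum (fun s => c s - p s) Fstar ∧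
        costSum (fun s => c s - p s) F''' < costSum (fun s => c s - p s) Fstar) := by
  subst hp
  have hx := costSum_sub_pddU_sub Fstar F' c w δ Δ
  have hy := costSum_sub_pddU_sub Fstar F''' c w δ Δ
  have hu := invw_sub_le_invw_sdiff hw Fstar F'
  have hv := invw_nonneg hw (Fstar \ F''')
  have ha : 0 < invw w Fstar - invw w F' := sub_pos.2 h1
  have hb : invw w Fstar - invw w F''' < 0 := sub_neg.2 h2
  unfold f7 at hδ
  set a := invw w Fstar - invw w F'
  set b := invw w Fstar - invw w F'''
  set x := costSum (fun s => c s - pddU Fstar w δ Δ s) Fstar -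
    costSum (fun s => c s - pddU Fstar w δ Δ s) F'
  set y := costSum (fun s => c s - pddU Fstar w δ Δ s) Fstar -
    costSum (fun s => c s - pddU Fstar w δ Δ s) F'''
  have hD : 0 < invw w (Fstar \ F') / a - invw w (Fstar \ F''') / b := by
    have := div_pos (ha.trans_le hu) ha
    have := div_nonpos_of_nonneg_of_nonpos hv hb.le
    linarith
  rw [div_le_iff₀ hD] at hδ
  have hxy : x / a ≤ y / b := by
    rw [hx, hy]
    have ha' := ha.ne'
    have hb' := hb.ne
    simp only [sub_div, mul_div_assoc, div_self ha', div_self hb'] at hδ ⊢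
    linarith
  refine ⟨fun ⟨hlt, heq⟩ => ?_, fun ⟨heq, hlt⟩ => ?_⟩
  · have hpos : 0 < x / a := div_pos (sub_pos.2 hlt) ha
    have hzero : y = 0 := sub_eq_zero.2 heq
    rw [hzero, zero_div] at hxy
    exact hxy.not_gt hpos
  · have hneg : y / b < 0 := div_neg_of_pos_of_neg (sub_pos.2 hlt) hb
    have hzero : x = 0 := sub_eq_zero.2 heq.symm
    rw [hzero, zero_div] at hxy
    exact hxy.not_gt hneg
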